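/- The induced representation functor U ↦ U □_L O from right L-comodules to k-vector spaces is faithfully exact: (a) if U' → U → U'' are L-colinear maps forming an exact sequence of k-vector spaces, then the induced sequence U' □_L O → U □_L O → U'' □_L O is exact; and (b) if U is a nonzero right L-comodule then U □_L O ≠ 0. -/

import Mathlib

open TensorProduct

namespace PaperQuotient

variable {k : Type} [Field k]

section Comod

variable (k) (O : Type) [AddCommGroup O] [Module k O] [Coalgebra k O]

/-- The axioms of a right `O`-comodule structure on `V` given by the coaction `ρ`. -/
structure IsComod {V : Type} [AddCommGroup V] [Module k V]
    (ρ : V →ₗ[k] V ⊗[k] O) : Prop where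
  coassoc : ∀ v : V,
    (TensorProduct.assoc k V O O) ((TensorProduct.map ρ (LinearMap.id : O →ₗ[k] O)) (ρ v)) =
      (TensorProduct.map (LinearMap.id : V →ₗ[k] V) (Coalgebra.comul (R := k))) (ρ v)
  counit : ∀ v : V,
    (TensorProduct.rid k V)
      ((TensorProduct.map (LinearMap.id : V →ₗ[k] V) (Coalgebra.counit (R := k))) (ρ v)) = v

/-- `f : V → W` is colinear with respect to the coactions `ρV` and `ρW`. -/
def IsColinear {V W : Type} [AddCommGroup V] [Module k V] [AddCommGroup W] [Module k W]
    (ρV : V →ₗ[k] V ⊗[k] O) (ρW : W →ₗ[k] W ⊗[k] O) (f : V →ₗ[k] W) : Prop :=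
  ∀ v : V, ρW (f v) = (TensorProduct.map f (LinearMap.id : O →ₗ[k] O)) (ρV v)

/-- The map `id ⊗ ε : V ⊗ O → V`. -/
noncomputable def counitMap {V : Type} [AddCommGroup V] [Module k V] :
    V ⊗[k] O →ₗ[k] V :=
  (TensorProduct.rid k V).toLinearMap ∘ₗ
    TensorProduct.map (LinearMap.id : V →ₗ[k] V) (Coalgebra.counit (R := k))

/-- The "free" right coaction `id_V ⊗ Δ` on `V ⊗ O`. -/
noncomputable def freeCoact {V : Type} [AddCommGroup V] [Module k V] :
    V ⊗[k] O →ₗ[k] (V ⊗[k] O) ⊗[k] O :=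
  (TensorProduct.assoc k V O O).symm.toLinearMap ∘ₗ
    LinearMap.lTensor V (Coalgebra.comul (R := k))

end Comod

section CotensorDef

variable (k)
variable {O : Type} [AddCommGroup O] [Module k O] [Coalgebra k O]
variable {L : Type} [AddCommGroup L] [Module k L]

/-- The difference of the two maps `U ⊗ O → U ⊗ (L ⊗ O)` whose equalizer is the
cotensor product `U □_L O`; here `ql : O → L` is the (linear) quotient map. -/
noncomputable def cotensorObstruction (ql : O →ₗ[k] L)
    {U : Type} [AddCommGroup U] [Module k U] (ρU : U →ₗ[k] U ⊗[k] L) :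
    U ⊗[k] O →ₗ[k] U ⊗[k] (L ⊗[k] O) :=
  (TensorProduct.assoc k U L O).toLinearMap ∘ₗ
      (TensorProduct.map ρU (LinearMap.id : O →ₗ[k] O))
    - TensorProduct.map (LinearMap.id : U →ₗ[k] U)
        ((TensorProduct.map ql (LinearMap.id : O →ₗ[k] O)) ∘ₗ Coalgebra.comul (R := k))

/-- The cotensor product `U □_L O` as a subspace of `U ⊗ O`. -/
noncomputable def cotensor (ql : O →ₗ[k] L)
    {U : Type} [AddCommGroup U] [Module k U] (ρU : U →ₗ[k] U ⊗[k] L) :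
    Submodule k (U ⊗[k] O) :=
  LinearMap.ker (cotensorObstruction k ql ρU)

end CotensorDef

section HopfSetup

variable (k)
variable (O : Type) [CommRing O] [HopfAlgebra k O]

/-- `A` is a Hopf subalgebra of `O`: it is closed under comultiplication and antipode. -/
structure IsHopfSub (A : Subalgebra k O) : Prop where
  comul_mem : ∀ a ∈ A, Coalgebra.comul (R := k) a ∈
    Submodule.span k {x : O ⊗[k] O | ∃ b ∈ A, ∃ c ∈ A, x = b ⊗ₜ[k] c}
  antipode_mem : ∀ a ∈ A, HopfAlgebra.antipode (R := k) a ∈ A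

/-- The set of elements of the augmentation ideal `A⁺ = A ∩ ker ε` of `A`. -/
def augSet (A : Subalgebra k O) : Set O :=
  {a : O | a ∈ A ∧ Coalgebra.counit (R := k) a = 0}

variable (L : Type) [CommRing L] [HopfAlgebra k L]

/-- `q : O → L` realizes `L` as the quotient Hopf algebra `O ⊗_A k = O/(A⁺O)`. -/
structure IsQuotientHopf (A : Subalgebra k O) (q : O →ₐc[k] L) : Prop where
  surj : Function.Surjective q
  ker : RingHom.ker (q : O →ₐ[k] L) = Ideal.span (augSet k O A)

/-- The coaction of `L` on an `O`-comodule obtained by restriction along `q`. -/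
noncomputable def resCoact (q : O →ₐc[k] L) {V : Type} [AddCommGroup V] [Module k V]
    (ρV : V →ₗ[k] V ⊗[k] O) : V →ₗ[k] V ⊗[k] L :=
  (LinearMap.lTensor V (q : O →ₗ[k] L)) ∘ₗ ρV

/-- The multiplication map `(U ⊗ O) ⊗ O → U ⊗ O`, `(u ⊗ g) ⊗ h ↦ u ⊗ gh`. -/
noncomputable def multMap (U : Type) [AddCommGroup U] [Module k U] :
    (U ⊗[k] O) ⊗[k] O →ₗ[k] U ⊗[k] O :=
  (LinearMap.lTensor U (LinearMap.mul' k O)) ∘ₗ (TensorProduct.assoc k U O O).toLinearMap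

/-- The diagonal coaction on the tensor product of two comodules. -/
noncomputable def tensorCoact {X Y : Type} [AddCommGroup X] [Module k X]
    [AddCommGroup Y] [Module k Y]
    (ρX : X →ₗ[k] X ⊗[k] O) (ρY : Y →ₗ[k] Y ⊗[k] O) :
    X ⊗[k] Y →ₗ[k] (X ⊗[k] Y) ⊗[k] O :=
  (TensorProduct.map (LinearMap.id : X ⊗[k] Y →ₗ[k] X ⊗[k] Y) (LinearMap.mul' k O)) ∘ₗ
    (TensorProduct.tensorTensorTensorComm k X O Y O).toLinearMap ∘ₗ
      (TensorProduct.map ρX ρY)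

/-- The diagonal coaction on `X ⊗ O`, `x ⊗ a ↦ Σ (x₀ ⊗ a₁) ⊗ x₁a₂`. -/
noncomputable def diagCoact {X : Type} [AddCommGroup X] [Module k X]
    (ρX : X →ₗ[k] X ⊗[k] O) :
    X ⊗[k] O →ₗ[k] (X ⊗[k] O) ⊗[k] O :=
  tensorCoact k O ρX (Coalgebra.comul (R := k))

end HopfSetup

end PaperQuotient

namespace PaperQuotient

/-- A bundled right `O`-comodule. -/
structure Comod (k O : Type) [Field k] [AddCommGroup O] [Module k O] [Coalgebra k O] where
  carrier : Type
  [acg : AddCommGroup carrier]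
  [mod : Module k carrier]
  ρ : carrier →ₗ[k] carrier ⊗[k] O
  comod : IsComod k O ρ

attribute [instance] Comod.acg Comod.mod

end PaperQuotient

/-- The ideal generated by the `s × s` minors of all families of `s` vectors of `K`. -/
def minorIdeal {R ι : Type*} [CommRing R] (K : Submodule R (ι → R)) (s : ℕ) : Ideal R :=
  Ideal.span {d | ∃ (X : Fin s → ι → R) (c : Fin s → ι),
    (∀ i, X i ∈ K) ∧ d = (Matrix.of fun i j => X i (c j)).det}

section MinorIdeal

variable {R ι : Type*} [CommRing R]

theorem minorIdeal_zero (K : Submodule R (ι → R)) (c : Fin 0 → ι) : minorIdeal K 0 = ⊤ :=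
  (Ideal.eq_top_iff_one _).2 <| Ideal.subset_span ⟨Fin.elim0, c, fun i => i.elim0, by simp⟩

theorem minorIdeal_eq_bot [Fintype ι] (K : Submodule R (ι → R)) {s : ℕ}
    (hs : Fintype.card ι < s) : minorIdeal K s = ⊥ := by
  refine Ideal.span_eq_bot.2 ?_
  rintro _ ⟨X, c, -, rfl⟩
  obtain ⟨i, j, hij, h⟩ := Fintype.exists_ne_map_eq_of_card_lt c (by simpa using hs)
  exact Matrix.det_zero_of_column_eq hij fun a => by simp [h]

theorem exists_linearMap_smul_of_mem_minorIdeal {K : Submodule R (ι → R)} {s : ℕ}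
    (hK : minorIdeal K (s + 1) = ⊥) {d : R} (hd : d ∈ minorIdeal K s) :
    ∃ P : (ι → R) →ₗ[R] (ι → R), (∀ v, P v ∈ K) ∧ ∀ v ∈ K, P v = d • v := by
  induction hd using Submodule.span_induction with
  | zero => exact ⟨0, fun _ => K.zero_mem, fun v _ => by simp⟩
  | add a b _ _ ha hb =>
    obtain ⟨P, hP, hP'⟩ := ha
    obtain ⟨Q, hQ, hQ'⟩ := hb
    exact ⟨P + Q, fun v => K.add_mem (hP v) (hQ v), fun v hv => by
      simp [hP' v hv, hQ' v hv, add_smul]⟩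
  | smul r a _ ha =>
    obtain ⟨P, hP, hP'⟩ := ha
    exact ⟨r • P, fun v => K.smul_mem r (hP v), fun v hv => by simp [hP' v hv, mul_smul]⟩
  | mem d hd =>
    obtain ⟨X, c, hX, rfl⟩ := hd
    set d := (Matrix.of fun i j => X i (c j)).det with hd
    let W (v : ι → R) (j : ι) : Matrix (Fin (s + 1)) (Fin (s + 1)) R :=
      Matrix.of fun a b => (Fin.cons v X : Fin (s + 1) → ι → R) a
        ((Fin.cons j c : Fin (s + 1) → ι) b)
    have hW (v j) : W v j = (W 0 j).updateRow 0
        fun b => v ((Fin.cons j c : Fin (s + 1) → ι) b) := by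
      ext a b
      refine Fin.cases ?_ (fun a => ?_) a
      · simp [W]
      · simp [W, Matrix.updateRow_apply]
    have expand (v j) : (W v j).det = v j * d + ∑ i : Fin s, (-1) ^ ((i : ℕ) + 1) * X i j *
        (Matrix.of fun a b =>
          (Fin.cons v X : Fin (s + 1) → ι → R) (i.succ.succAbove a) (c b)).det := by
      rw [Matrix.det_succ_column_zero, Fin.sum_univ_succ]
      simp [W, hd, Matrix.submatrix, Matrix.of_apply]
    let P : (ι → R) →ₗ[R] (ι → R) :=
      { toFun v j := v j * d - (W v j).det
        map_add' v w := by
          ext j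
          have : (W (v + w) j).det = (W v j).det + (W w j).det := by
            rw [hW, hW v, hW w, ← Matrix.det_updateRow_add]; rfl
          simp [this]; ring
        map_smul' r v := by
          ext j
          have : (W (r • v) j).det = r * (W v j).det := by
            rw [hW, hW v, ← Matrix.det_updateRow_smul]; rfl
          simp [this]; ring }
    refine ⟨P, fun v => ?_, fun v hv => ?_⟩
    · have : P v = ∑ i : Fin s, (-((-1) ^ ((i : ℕ) + 1) * (Matrix.of fun a b =>
          (Fin.cons v X : Fin (s + 1) → ι → R) (i.succ.succAbove a) (c b)).det)) • X i := by
        ext j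
        simp only [P, LinearMap.coe_mk, AddHom.coe_mk, expand, Finset.sum_apply, Pi.smul_apply,
          smul_eq_mul]
        rw [sub_add_cancel_left, ← Finset.sum_neg_distrib]
        exact Finset.sum_congr rfl fun i _ => by ring
      rw [this]
      exact K.sum_mem fun i _ => K.smul_mem _ (hX i)
    · have hdet (j) : (W v j).det = 0 := by
        rw [← Submodule.mem_bot R, ← hK]
        exact Ideal.subset_span ⟨Fin.cons v X, Fin.cons j c, Fin.cases hv hX, rfl⟩
      ext j
      simp [P, hdet, mul_comm]

/-- If all minor ideals of `K ⊆ Rⁿ` are trivial, then `K` is a direct summand. -/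
theorem exists_retraction_of_minorIdeal [Fintype ι] (K : Submodule R (ι → R))
    (h : ∀ s, minorIdeal K s = ⊥ ∨ minorIdeal K s = ⊤) :
    ∃ P : (ι → R) →ₗ[R] (ι → R), (∀ v, P v ∈ K) ∧ ∀ v ∈ K, P v = v := by
  cases subsingleton_or_nontrivial R
  · exact ⟨0, fun _ => K.zero_mem, fun v _ => Subsingleton.elim _ _⟩
  have hex : ∃ s, minorIdeal K s = ⊥ := ⟨_, minorIdeal_eq_bot K (Nat.lt_succ_self _)⟩
  classical
  obtain ⟨s, hs⟩ : ∃ s, Nat.find hex = s + 1 := Nat.exists_eq_succ_of_ne_zero fun h0 => by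
    have := Nat.find_spec hex
    rw [h0, minorIdeal_zero K Fin.elim0] at this
    exact top_ne_bot this
  have htop : minorIdeal K s = ⊤ := (h s).resolve_left (Nat.find_min hex (by omega))
  obtain ⟨P, hP, hP'⟩ := exists_linearMap_smul_of_mem_minorIdeal (hs ▸ Nat.find_spec hex)
    (htop ▸ Submodule.mem_top : (1 : R) ∈ minorIdeal K s)
  exact ⟨P, hP, fun v hv => by simpa using hP' v hv⟩

theorem det_mul_eq_sum {m p : Type*} [Fintype m] [DecidableEq m] [Fintype p] [DecidableEq p]
    (C : Matrix m p R) (Z : Matrix p m R) :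
    (C * Z).det = ∑ l : m → p, (∏ i, C i (l i)) * (Z.submatrix l id).det := by
  have h : C * Z = Matrix.of fun i => ∑ a, C i a • Z a := by
    ext i j
    simp [Matrix.mul_apply]
  rw [h]
  change Matrix.detRowAlternating.toMultilinearMap _ = _
  erw [MultilinearMap.map_sum]
  refine Finset.sum_congr rfl fun l _ => ?_
  erw [MultilinearMap.map_smul_univ]
  rfl

theorem map_minorIdeal_le {S : Type*} [CommRing S] [Fintype ι] (f g : R →+* S)
    (K : Submodule R (ι → R)) (N : Matrix ι ι S)
    (h : ∀ x ∈ K, ∃ Y ∈ Submodule.span S {y | ∃ z ∈ K, y = fun i => f (z i)},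
      ∀ j, g (x j) = ∑ i, Y i * N i j) (s : ℕ) :
    (minorIdeal K s).map g ≤ (minorIdeal K s).map f := by
  classical
  rw [minorIdeal, Ideal.map_span, Ideal.span_le]
  rintro _ ⟨_, ⟨X, c, hX, rfl⟩, rfl⟩
  choose Y hY hN using fun i => h (X i) (hX i)
  choose n C Z hZ using fun i => Submodule.mem_span_set'.1 (hY i)
  let Z' : Matrix (Σ i, Fin (n i)) ι S := Matrix.of fun a => (Z a.1 a.2 : ι → S)
  let C' : Matrix (Fin s) (Σ i, Fin (n i)) S :=
    Matrix.of fun i a => if a.1 = i then C a.1 a.2 else 0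
  let N' : Matrix ι (Fin s) S := N.submatrix id c
  have hmat : g.mapMatrix (Matrix.of fun i j => X i (c j)) = C' * (Z' * N') := by
    rw [← Matrix.mul_assoc]
    have hC : C' * Z' = Matrix.of Y := by
      ext i l
      rw [Matrix.mul_apply, Fintype.sum_sigma, Finset.sum_eq_single i]
      · simpa [C', Z'] using congrFun (hZ i) l
      · intro b _ hb
        simp [C', hb]
      · simp
    rw [hC]
    ext i j
    simp [Matrix.mul_apply, N', hN]
  rw [RingHom.map_det, hmat, det_mul_eq_sum]
  refine Ideal.sum_mem _ fun l _ => Ideal.mul_mem_left _ _ ?_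
  rw [← Matrix.det_transpose, show ((Z' * N').submatrix l id).transpose =
    N'.transpose * (Z'.submatrix l id).transpose by ext; simp [Matrix.mul_apply, mul_comm],
    det_mul_eq_sum]
  refine Ideal.sum_mem _ fun μ _ => Ideal.mul_mem_left _ _ ?_
  choose z hz hzZ using fun a : Σ i, Fin (n i) => (Z a.1 a.2).2
  have : (((Z'.submatrix l id).transpose).submatrix μ id).transpose =
      f.mapMatrix (Matrix.of fun i j => z (l i) (μ j)) := by
    ext i j
    simp [Z', hzZ (l i)]
  rw [← Matrix.det_transpose, this, ← RingHom.map_det]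
  exact Ideal.mem_map_of_mem _ (Ideal.subset_span ⟨_, _, fun i => hz (l i), rfl⟩)

end MinorIdeal

section Slice

variable {k : Type*} [Field k]

/-- The slice map `id ⊗ φ : M ⊗ N → M` of a linear functional `φ`. -/
noncomputable def slice (M : Type*) {N : Type*} [AddCommGroup M] [Module k M] [AddCommGroup N]
    [Module k N] (φ : N →ₗ[k] k) : M ⊗[k] N →ₗ[k] M :=
  (TensorProduct.rid k M).toLinearMap ∘ₗ LinearMap.lTensor M φ

@[simp]
theorem slice_tmul {M N : Type*} [AddCommGroup M] [Module k M] [AddCommGroup N]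
    [Module k N] (φ : N →ₗ[k] k) (m : M) (n : N) : slice M φ (m ⊗ₜ n) = φ n • m := by
  simp [slice]

theorem slice_rTensor {M M' N : Type*} [AddCommGroup M] [Module k M] [AddCommGroup M'] [Module k M']
    [AddCommGroup N] [Module k N] (φ : N →ₗ[k] k) (f : M →ₗ[k] M') (z : M ⊗[k] N) :
    slice M' φ (f.rTensor N z) = f (slice M φ z) := by
  induction z with
  | zero => simp
  | add x y hx hy => simp [hx, hy]
  | tmul m n => simp

theorem slice_tmul_one_mul {B N : Type*} [CommRing B] [Algebra k B] [CommRing N] [Algebra k N]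
    (φ : N →ₗ[k] k) (b : B) (z : B ⊗[k] N) :
    slice B φ ((b ⊗ₜ 1) * z) = b * slice B φ z := by
  induction z with
  | zero => simp
  | add x y hx hy => simp [mul_add, hx, hy]
  | tmul m n => simp

theorem mem_range_rTensor_of_slice_mem {M N : Type*} [AddCommGroup M] [Module k M] [AddCommGroup N]
    [Module k N] (V : Submodule k M) (z : M ⊗[k] N) (h : ∀ φ : N →ₗ[k] k, slice M φ z ∈ V) :
    z ∈ LinearMap.range (LinearMap.rTensor N V.subtype) := by
  classical
  let b := Module.Basis.ofVectorSpace k N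
  have hz := (TensorProduct.equivFinsuppOfBasisRight (M := M) b).symm_apply_apply z
  rw [TensorProduct.equivFinsuppOfBasisRight_symm_apply] at hz
  rw [← hz]
  refine Submodule.sum_mem _ fun i _ => ?_
  refine ⟨⟨slice M (b.coord i) z, h _⟩ ⊗ₜ b i, ?_⟩
  rw [TensorProduct.equivFinsuppOfBasisRight_apply]
  rfl

end Slice

section Subcomodule

variable {k O : Type*} [Field k] [CommRing O] [HopfAlgebra k O]

/-- `V ⊆ O` is a right subcomodule of the regular comodule. -/
def IsSubcomodule (V : Submodule k O) : Prop :=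
  ∀ w ∈ V, Coalgebra.comul (R := k) w ∈ LinearMap.range (LinearMap.rTensor O V.subtype)

theorem IsSubcomodule.sup {V W : Submodule k O} (hV : IsSubcomodule V) (hW : IsSubcomodule W) :
    IsSubcomodule (V ⊔ W) := by
  have mono {V W : Submodule k O} (h : V ≤ W) : LinearMap.range (LinearMap.rTensor O V.subtype) ≤
      LinearMap.range (LinearMap.rTensor O W.subtype) := by
    rw [show V.subtype = W.subtype ∘ₗ Submodule.inclusion h from rfl, LinearMap.rTensor_comp]
    exact LinearMap.range_comp_le_range _ _
  intro x hx
  obtain ⟨v, hv, w, hw, rfl⟩ := Submodule.mem_sup.1 hx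
  rw [map_add]
  exact Submodule.add_mem _ (mono le_sup_left (hV v hv)) (mono le_sup_right (hW w hw))

/-- Every element of `O` lies in a finite-dimensional subcomodule. -/
theorem exists_isSubcomodule_mem (v : O) :
    ∃ V : Submodule k O, FiniteDimensional k V ∧ IsSubcomodule V ∧ v ∈ V := by
  classical
  let F : (O →ₗ[k] k) →ₗ[k] O :=
    { toFun φ := slice O φ (Coalgebra.comul (R := k) v)
      map_add' φ ψ := by simp [slice, LinearMap.lTensor_add]
      map_smul' r φ := by simp [slice, LinearMap.lTensor_smul] }
  refine ⟨LinearMap.range F, ?_, ?_, ⟨Coalgebra.counit, ?_⟩⟩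
  · let R := Coalgebra.Repr.arbitrary k v
    have := FiniteDimensional.span_finset k (R.index.image R.left)
    refine Submodule.finiteDimensional_of_le
      (S₂ := Submodule.span k (R.index.image R.left : Set O)) ?_
    rintro _ ⟨φ, rfl⟩
    change slice O φ (Coalgebra.comul v) ∈ _
    rw [← R.eq, map_sum]
    refine Submodule.sum_mem _ fun i hi => ?_
    rw [slice_tmul]
    exact Submodule.smul_mem _ _ (Submodule.subset_span (Finset.mem_image_of_mem _ hi))
  · rintro _ ⟨φ, rfl⟩
    refine mem_range_rTensor_of_slice_mem _ _ fun ψ => ?_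
    refine ⟨LinearMap.mul' k k ∘ₗ TensorProduct.map ψ φ ∘ₗ Coalgebra.comul, ?_⟩
    have h := Coalgebra.coassoc_apply (R := k) v
    have key : ∀ z : O ⊗[k] O,
        slice O (LinearMap.mul' k k ∘ₗ TensorProduct.map ψ φ ∘ₗ Coalgebra.comul) z
        = slice O (LinearMap.mul' k k ∘ₗ TensorProduct.map ψ φ) (Coalgebra.comul.lTensor O z) := by
      intro z
      induction z with
      | zero => simp
      | add x y hx hy => simp only [map_add, hx, hy]
      | tmul m n => simp
    have key2 : ∀ z : (O ⊗[k] O) ⊗[k] O, slice O (LinearMap.mul' k k ∘ₗ TensorProduct.map ψ φ)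
        (TensorProduct.assoc k O O O z) = slice O ψ (slice (O ⊗[k] O) φ z) := by
      intro z
      induction z with
      | zero => simp
      | add x y hx hy => simp only [map_add, hx, hy]
      | tmul m n =>
        induction m with
        | zero => simp
        | add x y hx hy => simp only [TensorProduct.add_tmul, map_add, hx, hy]
        | tmul m m' => simp [smul_smul, mul_comm]
    change slice O _ _ = slice O ψ (Coalgebra.comul (slice O φ _))
    rw [key, ← h, key2, slice_rTensor]
  · change slice O _ _ = v
    simp [slice, Coalgebra.lTensor_counit_comul]

theorem exists_isSubcomodule_forall_mem {ι : Type*} [Finite ι] (x : ι → O) :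
    ∃ V : Submodule k O, FiniteDimensional k V ∧ IsSubcomodule V ∧ ∀ i, x i ∈ V := by
  classical
  have := Fintype.ofFinite ι
  suffices ∀ s : Finset ι, ∃ V : Submodule k O, FiniteDimensional k V ∧ IsSubcomodule V ∧
      ∀ i ∈ s, x i ∈ V by simpa using this Finset.univ
  intro s
  induction s using Finset.induction_on with
  | empty => exact ⟨⊥, inferInstance, fun w hw => by simp [(Submodule.mem_bot k).1 hw], by simp⟩
  | insert a s _ ih =>
    obtain ⟨V, _, hV, hx⟩ := ih
    obtain ⟨W, _, hW, hxW⟩ := exists_isSubcomodule_mem (k := k) (x a)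
    refine ⟨W ⊔ V, inferInstance, hW.sup hV, fun i hi => ?_⟩
    rcases Finset.mem_insert.1 hi with rfl | hi
    · exact Submodule.mem_sup_left hxW
    · exact Submodule.mem_sup_right (hx i hi)

/-- A finite-dimensional subcomodule has a basis with an invertible matrix of coefficients. -/
theorem IsSubcomodule.exists_matrix {V : Submodule k O} [FiniteDimensional k V]
    (hV : IsSubcomodule V) : ∃ (n : ℕ) (v : Fin n → O) (T N : Matrix (Fin n) (Fin n) O),
      V = Submodule.span k (Set.range v) ∧
      (∀ j, Coalgebra.comul (R := k) (v j) = ∑ i, v i ⊗ₜ[k] T i j) ∧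
      ∀ l j, ∑ i, N i l * T i j = if l = j then 1 else 0 := by
  classical
  let b := Module.finBasis k V
  choose z hz using fun j => hV (b j) (b j).2
  let T : Matrix (Fin _) (Fin _) O :=
    Matrix.of fun i j => TensorProduct.equivFinsuppOfBasisLeft b (z j) i
  have hzT (j) : z j = ∑ i, b i ⊗ₜ[k] T i j := by
    conv_lhs => rw [← (TensorProduct.equivFinsuppOfBasisLeft (N := O) b).symm_apply_apply (z j)]
    rw [TensorProduct.equivFinsuppOfBasisLeft_symm_apply, Finsupp.sum_fintype _ _ (by simp)]
    rfl
  have hT (j) : Coalgebra.comul (R := k) (b j : O) = ∑ i, (b i : O) ⊗ₜ[k] T i j := by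
    rw [← hz, hzT]
    simp
  refine ⟨_, fun i => b i, T, Matrix.of fun i l => HopfAlgebra.antipode k (T l i), ?_, hT, ?_⟩
  · have := congrArg (Submodule.map V.subtype) b.span_eq
    rw [Submodule.map_span, Submodule.map_top, Submodule.range_subtype, ← Set.range_comp] at this
    exact this.symm
  · intro l j
    have h := congrArg ((LinearMap.mul' k O ∘ₗ
      (HopfAlgebra.antipode k).rTensor O).lTensor O) (Coalgebra.coassoc_apply (R := k) (b j : O))
    rw [← LinearMap.lTensor_comp_apply, LinearMap.comp_assoc,
      HopfAlgebra.mul_antipode_rTensor_comul, hT] at h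
    simp only [map_sum, LinearMap.rTensor_tmul, LinearMap.lTensor_tmul, hT, TensorProduct.sum_tmul,
      TensorProduct.assoc_tmul, LinearMap.comp_apply, LinearMap.mul'_apply] at h
    rw [Finset.sum_comm] at h
    simp only [← TensorProduct.tmul_sum] at h
    have hc := congrArg ((Algebra.linearMap k O).lTensor O)
      (Coalgebra.lTensor_counit_comul (R := k) (b j : O))
    simp only [hT, map_sum, LinearMap.lTensor_tmul, Algebra.linearMap_apply, map_one] at hc
    simp only [Algebra.linearMap_apply, hc] at h
    have hb : ∑ x, b x ⊗ₜ[k] ∑ a, HopfAlgebra.antipode k (T x a) * T a j = b j ⊗ₜ[k] (1 : O) := by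
      refine Module.Flat.rTensor_preserves_injective_linearMap (M := O) V.subtype
        V.subtype_injective ?_
      simpa using h
    have hl := congrArg (fun z => TensorProduct.equivFinsuppOfBasisLeft b z l) hb
    simp only [map_sum, Finsupp.coe_finsetSum, Finset.sum_apply,
      TensorProduct.equivFinsuppOfBasisLeft_apply_tmul_apply, Module.Basis.repr_self,
      Finsupp.single_apply, ite_smul, one_smul, zero_smul, Finset.sum_ite_eq', Finset.mem_univ,
      if_true] at hl
    simpa [eq_comm] using hl

end Subcomodule

section FaithfullyFlat

open PaperQuotient Coalgebra

variable {k O : Type} [Field k] [CommRing O] [HopfAlgebra k O] {A : Subalgebra k O}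

theorem PaperQuotient.IsHopfSub.exists_comul (hA : IsHopfSub k O A) :
    ∃ D : A →ₐ[k] A ⊗[k] A,
      ∀ a, Algebra.TensorProduct.map A.val A.val (D a) = comul (R := k) (a : O) := by
  let i : A ⊗[k] A →ₐ[k] O ⊗[k] O := Algebra.TensorProduct.map A.val A.val
  have hi : Function.Injective i :=
    TensorProduct.map_injective_of_flat_flat A.val.toLinearMap A.val.toLinearMap
      Subtype.val_injective Subtype.val_injective
  have hmem (a : A) : comul (R := k) (a : O) ∈ i.range := by
    have h := hA.comul_mem a a.2
    have hle : Submodule.span k {x : O ⊗[k] O | ∃ b ∈ A, ∃ c ∈ A, x = b ⊗ₜ[k] c} ≤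
        Subalgebra.toSubmodule i.range := by
      rw [Submodule.span_le]
      rintro _ ⟨b, hb, c, hc, rfl⟩
      exact ⟨⟨b, hb⟩ ⊗ₜ ⟨c, hc⟩, by simp [i]⟩
    exact hle h
  refine ⟨(AlgEquiv.ofInjective i hi).symm.toAlgHom.comp
    (((Bialgebra.comulAlgHom k O).comp A.val).codRestrict i.range hmem), fun a => ?_⟩
  exact congrArg Subtype.val ((AlgEquiv.ofInjective i hi).apply_symm_apply ⟨_, hmem a⟩)

/-- A `Δ`-stable ideal of a Hopf subalgebra is trivial. -/
theorem PaperQuotient.IsHopfSub.eq_bot_or_eq_top_of_map_le {D : A →ₐ[k] A ⊗[k] A}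
    (hA : IsHopfSub k O A)
    (hD : ∀ a, Algebra.TensorProduct.map A.val A.val (D a) = comul (R := k) (a : O))
    (J : Ideal A)
    (hJ : J.map ((Algebra.TensorProduct.map (AlgHom.id k A) A.val).comp D) ≤
      J.map (Algebra.TensorProduct.includeLeft : A →ₐ[k] A ⊗[k] O)) : J = ⊥ ∨ J = ⊤ := by
  let δ : A →ₐ[k] A ⊗[k] O := (Algebra.TensorProduct.map (AlgHom.id k A) A.val).comp D
  have hδ (a : A) :
      Algebra.TensorProduct.map A.val (AlgHom.id k O) (δ a) = comul (R := k) (a : O) := by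
    rw [← hD]
    change ((Algebra.TensorProduct.map A.val (AlgHom.id k O)).comp
      (Algebra.TensorProduct.map (AlgHom.id k A) A.val)) (D a) = _
    congr 1
    ext <;> simp
  by_cases h : ∀ a ∈ J, counit (R := k) (a : O) = 0
  · left
    rw [eq_bot_iff]
    intro a ha
    let e : A ⊗[k] O →ₐ[k] O := Algebra.TensorProduct.lift
      ((Algebra.ofId k O).comp ((Bialgebra.counitAlgHom k O).comp A.val)) (AlgHom.id k O)
      fun _ _ => Commute.all _ _
    have he (z) : e z = (TensorProduct.lid k O) ((counit (R := k)).rTensor O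
        (Algebra.TensorProduct.map A.val (AlgHom.id k O) z)) := by
      induction z with
      | zero => simp
      | add x y hx hy => simp only [map_add, hx, hy]
      | tmul x y => simp [e, Algebra.smul_def, Algebra.ofId_apply]
    have hker : J.map (Algebra.TensorProduct.includeLeft : A →ₐ[k] A ⊗[k] O) ≤ RingHom.ker e := by
      rw [Ideal.map_le_iff_le_comap]
      intro b hb
      simp [RingHom.mem_ker, e, h b hb]
    have := hker (hJ (Ideal.mem_map_of_mem _ ha))
    rw [RingHom.mem_ker] at this
    change e (δ a) = 0 at this
    rw [he, hδ, rTensor_counit_comul] at this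
    simpa using this
  · right
    push Not at h
    obtain ⟨a, ha, hε⟩ := h
    let S : A →ₐ[k] A := ((HopfAlgebra.antipodeAlgHom k O).comp A.val).codRestrict A
      fun x => hA.antipode_mem x x.2
    let π : A →ₐ[k] A ⧸ J := Ideal.Quotient.mkₐ k J
    have : Module.Free k (A ⧸ J) := Module.Free.of_divisionRing k _
    have : Module.Flat k (A ⧸ J) := Module.Flat.of_free
    have hz : Algebra.TensorProduct.map π (AlgHom.id k A) (D a) = 0 := by
      have hinj : Function.Injective (Algebra.TensorProduct.map (AlgHom.id k (A ⧸ J)) A.val) :=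
        Module.Flat.lTensor_preserves_injective_linearMap (M := A ⧸ J) A.val.toLinearMap
          Subtype.val_injective
      apply hinj
      have hker : J.map (Algebra.TensorProduct.includeLeft : A →ₐ[k] A ⊗[k] O) ≤
          RingHom.ker (Algebra.TensorProduct.map π (AlgHom.id k O)) := by
        rw [Ideal.map_le_iff_le_comap]
        intro b hb
        simp [RingHom.mem_ker, π, Ideal.Quotient.eq_zero_iff_mem.2 hb]
      have := hker (hJ (Ideal.mem_map_of_mem _ ha))
      rw [RingHom.mem_ker] at this
      rw [map_zero, ← this]
      change ((Algebra.TensorProduct.map _ _).comp (Algebra.TensorProduct.map _ _)) (D a) =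
        ((Algebra.TensorProduct.map _ _).comp (Algebra.TensorProduct.map _ _)) (D a)
      congr 1
      ext <;> simp
    have hS : Algebra.TensorProduct.lift (AlgHom.id k A) S (fun _ _ => Commute.all _ _) (D a) =
        algebraMap k A (counit (R := k) (a : O)) := by
      apply Subtype.val_injective
      have h1 : ∀ z,
          ((Algebra.TensorProduct.lift (AlgHom.id k A) S (fun _ _ => Commute.all _ _) z : A) : O)
          = LinearMap.mul' k O ((HopfAlgebra.antipode k).lTensor O
            (Algebra.TensorProduct.map A.val A.val z)) := by
        intro z
        induction z with
        | zero => simp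
        | add x y hx hy => simp only [map_add, ← hx, ← hy]; rfl
        | tmul x y => simp [S]; rfl
      rw [h1, hD, HopfAlgebra.mul_antipode_lTensor_comul_apply]
      rfl
    have hq : π (algebraMap k A (counit (R := k) (a : O))) = 0 := by
      have h2 := congrArg (Algebra.TensorProduct.lift (AlgHom.id k (A ⧸ J)) (π.comp S)
        (fun _ _ => Commute.all _ _)) hz
      rw [map_zero] at h2
      rw [← hS, ← h2]
      change (π.comp (Algebra.TensorProduct.lift (AlgHom.id k A) S fun _ _ => Commute.all _ _)) (D a) =
        ((Algebra.TensorProduct.lift (AlgHom.id k (A ⧸ J)) (π.comp S)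
          fun _ _ => Commute.all _ _).comp (Algebra.TensorProduct.map π (AlgHom.id k A))) (D a)
      congr 1
      ext <;> simp
    refine Ideal.eq_top_of_isUnit_mem _ (Ideal.Quotient.eq_zero_iff_mem.1 hq) ?_
    exact (IsUnit.mk0 _ hε).map _

/-- The vectors of coefficients `x` with `∑ xᵢ vᵢ ∈ A`. -/
def coeffSubmodule {ι : Type*} [Fintype ι] (A : Subalgebra k O) (v : ι → O) :
    Submodule A (ι → A) where
  carrier := {x | ∑ i, (x i : O) * v i ∈ A}
  zero_mem' := by simp
  add_mem' {x y} hx hy := by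
    simpa [add_mul, Finset.sum_add_distrib] using A.add_mem hx hy
  smul_mem' a x hx := by
    simpa [Finset.mul_sum, mul_assoc] using A.mul_mem a.2 hx

theorem mem_coeffSubmodule {ι : Type*} [Fintype ι] {v : ι → O} {x : ι → A} :
    x ∈ coeffSubmodule A v ↔ ∑ i, (x i : O) * v i ∈ A := Iff.rfl

theorem PaperQuotient.IsHopfSub.exists_retraction_coeffSubmodule (hA : IsHopfSub k O A)
    {n : ℕ} (v : Fin n → O)
    (T N : Matrix (Fin n) (Fin n) O)
    (hT : ∀ j, comul (R := k) (v j) = ∑ i, v i ⊗ₜ[k] T i j)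
    (hN : ∀ l j, ∑ i, N i l * T i j = if l = j then 1 else 0) :
    ∃ P : (Fin n → A) →ₗ[A] (Fin n → A), (∀ x, P x ∈ coeffSubmodule A v) ∧
      ∀ x ∈ coeffSubmodule A v, P x = x := by
  classical
  obtain ⟨D, hD⟩ := hA.exists_comul
  refine exists_retraction_of_minorIdeal _ fun s => hA.eq_bot_or_eq_top_of_map_le hD _ ?_
  let δ : A →ₐ[k] A ⊗[k] O := (Algebra.TensorProduct.map (AlgHom.id k A) A.val).comp D
  let j : A ⊗[k] O →ₐ[k] O ⊗[k] O := Algebra.TensorProduct.map A.val (AlgHom.id k O)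
  have hδ (a : A) : j (δ a) = comul (R := k) (a : O) := by
    rw [← hD]
    change ((Algebra.TensorProduct.map A.val (AlgHom.id k O)).comp
      (Algebra.TensorProduct.map (AlgHom.id k A) A.val)) (D a) = _
    congr 1
    ext <;> simp
  refine map_minorIdeal_le (Algebra.TensorProduct.includeLeft : A →ₐ[k] A ⊗[k] O).toRingHom
    δ.toRingHom _ (Matrix.of fun i l => 1 ⊗ₜ N i l) (fun x hx => ?_) s
  let Y (i : Fin n) : A ⊗[k] O := ∑ l, δ (x l) * 1 ⊗ₜ T i l
  refine ⟨Y, ?_, fun l => ?_⟩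
  · let b := Module.Basis.ofVectorSpace k O
    let y (m) (i : Fin n) : A := slice A (b.coord m) (Y i)
    have hy (m) : y m ∈ coeffSubmodule A v := by
      have hYv : ∑ i, (v i ⊗ₜ[k] (1 : O)) * j (Y i) = j (δ ⟨_, hx⟩) := by
        rw [hδ]
        simp only [Y, map_sum, map_mul, hδ, Bialgebra.comul_mul, hT, Finset.mul_sum]
        rw [Finset.sum_comm]
        refine Finset.sum_congr rfl fun l _ => Finset.sum_congr rfl fun i _ => ?_
        rw [mul_left_comm]
        simp [j]
      have h := congrArg (slice O (b.coord m)) hYv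
      have hj (z) : slice O (b.coord m) (j z) = slice A (b.coord m) z :=
        slice_rTensor (b.coord m) A.val.toLinearMap z
      simp only [map_sum, slice_tmul_one_mul, hj] at h
      rw [mem_coeffSubmodule]
      simp only [y, mul_comm _ (v _)]
      rw [h]
      exact Subtype.prop _
    let c (i : Fin n) := TensorProduct.equivFinsuppOfBasisRight b (Y i)
    let t := Finset.univ.biUnion fun i => (c i).support
    have hY : Y = ∑ m ∈ t, (1 ⊗ₜ[k] b m : A ⊗[k] O) • fun i =>
        (Algebra.TensorProduct.includeLeft : A →ₐ[k] A ⊗[k] O).toRingHom (y m i) := by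
      ext1 i
      have hz := (TensorProduct.equivFinsuppOfBasisRight (M := A) b).symm_apply_apply (Y i)
      rw [TensorProduct.equivFinsuppOfBasisRight_symm_apply, Finsupp.sum_of_support_subset (s := t) _
        (Finset.subset_biUnion_of_mem (fun i => (c i).support) (Finset.mem_univ i)) _ (by simp)] at hz
      conv_lhs => rw [← hz]
      rw [Finset.sum_apply]
      refine Finset.sum_congr rfl fun m _ => ?_
      rw [TensorProduct.equivFinsuppOfBasisRight_apply]
      simp [y, slice]
    rw [hY]
    exact Submodule.sum_mem _ fun m _ => Submodule.smul_mem _ _ <|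
      Submodule.subset_span ⟨y m, hy m, rfl⟩
  · simp only [Y, Finset.sum_mul, Matrix.of_apply]
    rw [Finset.sum_comm]
    simp only [mul_assoc, ← Finset.mul_sum, Algebra.TensorProduct.tmul_mul_tmul, mul_one,
      ← TensorProduct.tmul_sum]
    simp only [mul_comm (T _ _), hN]
    rw [Finset.sum_eq_single l] <;> simp +contextual [eq_comm, ← Algebra.TensorProduct.one_def]

/-- Finitely many elements of `O` lie in an `A`-submodule of the form `A ⊕ (projective)`. -/
theorem PaperQuotient.IsHopfSub.exists_decomposition (hA : IsHopfSub k O A)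
    {ι : Type*} [Fintype ι] (x : ι → O) :
    ∃ (n : ℕ) (v : Fin n → O) (a : ι → A) (z : ι → Fin n → A),
      (∀ i, x i = a i + ∑ j, (z i j : O) * v j) ∧
      ∀ f : ι → A, ∑ i, (f i : O) * x i ∈ A → (∀ j, ∑ i, f i * z i j = 0) ∧
        ∑ i, (f i : O) * x i = (∑ i, f i * a i : A) := by
  obtain ⟨V, _, hV, hx⟩ := exists_isSubcomodule_forall_mem (k := k) x
  obtain ⟨n, v, T, N, rfl, hT, hN⟩ := hV.exists_matrix
  obtain ⟨P, hP, hP'⟩ := hA.exists_retraction_coeffSubmodule v T N hT hN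
  choose c hc using fun i => (Submodule.mem_span_range_iff_exists_fun k).1 (hx i)
  let y (i : ι) (j : Fin n) : A := algebraMap k A (c i j)
  have hy (i) : x i = ∑ j, (y i j : O) * v j := by
    rw [← hc]
    exact Finset.sum_congr rfl fun j _ => Algebra.smul_def _ _
  have hx' (i : ι) : x i = (⟨_, hP (y i)⟩ : A) + ∑ j, ((y i - P (y i)) j : O) * v j := by
    simp [hy i, sub_mul]
  refine ⟨n, v, fun i => ⟨_, hP (y i)⟩, fun i => y i - P (y i), hx', fun f hf => ?_⟩
  have hz (j : Fin n) : ∑ i, f i * (y i - P (y i)) j = 0 := by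
    have hmem : ∑ i, f i • y i ∈ coeffSubmodule A v := by
      rw [mem_coeffSubmodule]
      convert hf using 1
      simp only [hy, Finset.sum_apply, Finset.mul_sum]
      rw [Finset.sum_comm]
      refine Finset.sum_congr rfl fun j _ => ?_
      simp [Finset.sum_mul, mul_assoc]
    have h := congrFun (hP' _ hmem) j
    simp only [map_sum, map_smul, Finset.sum_apply, Pi.smul_apply, smul_eq_mul] at h
    simp [mul_sub, h]
  refine ⟨hz, ?_⟩
  have hz' : ∑ i, (f i : O) * ∑ j, ((y i - P (y i)) j : O) * v j = 0 := by
    simp only [Finset.mul_sum, ← mul_assoc]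
    rw [Finset.sum_comm]
    refine Finset.sum_eq_zero fun j _ => ?_
    rw [← Finset.sum_mul]
    have := congrArg Subtype.val (hz j)
    push_cast at this
    rw [this, zero_mul]
  rw [Finset.sum_congr rfl fun i _ => congrArg ((f i : O) * ·) (hx' i)]
  simp only [mul_add, Finset.sum_add_distrib, hz', add_zero]
  simp

/-- A commutative Hopf algebra is faithfully flat over its Hopf subalgebras. -/
theorem PaperQuotient.IsHopfSub.faithfullyFlat (hA : IsHopfSub k O A) :
    Module.FaithfullyFlat A O := by
  have hflat : Module.Flat A O := by
    refine Module.Flat.of_forall_isTrivialRelation fun {l f x} hfx => ?_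
    simp only [Algebra.smul_def] at hfx
    change ∑ i, (f i : O) * x i = 0 at hfx
    obtain ⟨n, v, a, z, hx, hz⟩ := hA.exists_decomposition x
    obtain ⟨hz, ha⟩ := hz f (hfx ▸ A.zero_mem)
    refine ⟨n + 1, fun i => Fin.cons (a i) (z i), Fin.cons 1 v, fun i => ?_, Fin.cases ?_ hz⟩
    · simp only [Fin.sum_univ_succ, Fin.cons_zero, Fin.cons_succ, Algebra.smul_def, mul_one, hx i]
      rfl
    · exact Subtype.val_injective (ha.symm.trans hfx)
  rw [Module.FaithfullyFlat.iff_flat_and_ideal_smul_eq_top]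
  refine ⟨hflat, fun I hI => ?_⟩
  have h1 : (1 : O) ∈ I • Submodule.span A (Set.range (id : O → O)) := by simp [hI]
  rw [Submodule.mem_ideal_smul_span_iff_exists_sum] at h1
  obtain ⟨c, hc, h1⟩ := h1
  rw [Finsupp.sum, ← Finset.sum_coe_sort] at h1
  simp only [Algebra.smul_def, id] at h1
  change ∑ i : c.support, (c i : O) * (i : O) = 1 at h1
  obtain ⟨n, v, a, z, hx, hz⟩ := hA.exists_decomposition (fun i : c.support => (i : O))
  rw [Ideal.eq_top_iff_one]
  have : ∑ i : c.support, c i * a i = 1 :=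
    Subtype.val_injective <| (hz (fun i => c i) (h1 ▸ A.one_mem)).2.symm.trans h1
  rw [← this]
  exact I.sum_mem fun i _ => I.mul_mem_right _ (hc i)

end FaithfullyFlat

section Descent

open PaperQuotient Coalgebra

variable {k O L : Type} [Field k] [CommRing O] [HopfAlgebra k O] [CommRing L] [HopfAlgebra k L]
variable {A : Subalgebra k O} {q : O →ₐc[k] L}
variable {R : Type} [CommRing R] [Algebra k R] [Algebra R O] [IsScalarTower k R O]

theorem PaperQuotient.IsQuotientHopf.map_coe (hq : IsQuotientHopf k O L A q) (a : A) :
    q (a : O) = algebraMap k L (counit (R := k) (a : O)) := by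
  have h : (a : O) - algebraMap k O (counit (R := k) (a : O)) ∈ RingHom.ker (q : O →ₐ[k] L) := by
    rw [hq.ker]
    refine Ideal.subset_span ⟨A.sub_mem a.2 (A.algebraMap_mem _), ?_⟩
    simp
  rw [RingHom.mem_ker, map_sub, sub_eq_zero] at h
  simpa using h

variable (k q) in
/-- The algebra map `g ↦ ∑ g₍₂₎ ⊗ q(g₍₁₎)`. -/
noncomputable def leftCoactHom : O →ₐ[k] O ⊗[k] L :=
  (Algebra.TensorProduct.map (AlgHom.id k O) (q : O →ₐ[k] L)).comp
    ((Algebra.TensorProduct.comm k O O).toAlgHom.comp (Bialgebra.comulAlgHom k O))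

theorem leftCoactHom_apply (g : O) : leftCoactHom k q g =
    Algebra.TensorProduct.map (AlgHom.id k O) (q : O →ₐ[k] L)
      (Algebra.TensorProduct.comm k O O (comul (R := k) g)) := rfl

theorem PaperQuotient.IsQuotientHopf.leftCoactHom_coe (hA : IsHopfSub k O A)
    (hq : IsQuotientHopf k O L A q) (a : A) : leftCoactHom k q (a : O) = (a : O) ⊗ₜ 1 := by
  obtain ⟨D, hD⟩ := hA.exists_comul
  have h : ∀ z, Algebra.TensorProduct.map (AlgHom.id k O) (q : O →ₐ[k] L)
      (Algebra.TensorProduct.comm k O O (Algebra.TensorProduct.map A.val A.val z)) =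
      TensorProduct.lid k O ((counit (R := k)).rTensor O
        (Algebra.TensorProduct.map A.val A.val z)) ⊗ₜ 1 := by
    intro z
    induction z with
    | zero => simp
    | add x y hx hy => simp only [map_add, hx, hy, TensorProduct.add_tmul]
    | tmul x y => simp [hq.map_coe, Algebra.algebraMap_eq_smul_one, TensorProduct.smul_tmul]
  rw [leftCoactHom_apply, ← hD, h, hD, rTensor_counit_comul]
  simp

variable (k R) in
/-- The algebra map `x ⊗ y ↦ S(y) ⊗ x`. -/
noncomputable def antipodeSwapHom : O ⊗[k] O →ₐ[k] O ⊗[R] O :=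
  Algebra.TensorProduct.lift
    ((Algebra.TensorProduct.includeRight : O →ₐ[R] O ⊗[R] O).restrictScalars k)
    ((Algebra.TensorProduct.includeLeft : O →ₐ[k] O ⊗[R] O).comp (HopfAlgebra.antipodeAlgHom k O))
    fun _ _ => Commute.all _ _

theorem antipodeSwapHom_tmul (x y : O) :
    antipodeSwapHom k R (x ⊗ₜ y) = HopfAlgebra.antipode k y ⊗ₜ x := by
  simp [antipodeSwapHom]

theorem antipodeSwapHom_comul_coe (hA : IsHopfSub k O A) (a : A) :
    antipodeSwapHom k A (comul (R := k) (a : O)) =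
      algebraMap k O (counit (R := k) (a : O)) ⊗ₜ 1 := by
  obtain ⟨D, hD⟩ := hA.exists_comul
  have h : ∀ z, antipodeSwapHom k A (Algebra.TensorProduct.map A.val A.val z) =
      (LinearMap.mul' k O ((HopfAlgebra.antipode k).lTensor O
        (Algebra.TensorProduct.map A.val A.val z))) ⊗ₜ 1 := by
    intro z
    induction z with
    | zero => simp
    | add x y hx hy => simp only [map_add, hx, hy, TensorProduct.add_tmul]
    | tmul x y =>
      have hx : (x : O) = x • (1 : O) := by simp [Algebra.smul_def]
      simp only [Algebra.TensorProduct.map_tmul, Subalgebra.coe_val, antipodeSwapHom_tmul,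
        LinearMap.lTensor_tmul, LinearMap.mul'_apply]
      rw [hx, ← TensorProduct.smul_tmul]
      simp [Algebra.smul_def]
  rw [← hD, h, hD, HopfAlgebra.mul_antipode_lTensor_comul_apply]

theorem PaperQuotient.IsQuotientHopf.exists_section (hA : IsHopfSub k O A)
    (hq : IsQuotientHopf k O L A q) :
    ∃ β : L →ₗ[k] O ⊗[A] O, ∀ g, β (q g) = antipodeSwapHom k A (comul (R := k) g) := by
  let B : O →ₐ[k] O ⊗[A] O := (antipodeSwapHom k A).comp (Bialgebra.comulAlgHom k O)
  have hker : RingHom.ker (q : O →ₐ[k] L) ≤ RingHom.ker B := by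
    rw [hq.ker, Ideal.span_le]
    rintro a ⟨ha, hε⟩
    change antipodeSwapHom k A (comul (R := k) a) = 0
    rw [antipodeSwapHom_comul_coe hA ⟨a, ha⟩, hε]
    simp
  obtain ⟨s, hs⟩ := (q : O →ₗ[k] L).exists_rightInverse_of_surjective
    (LinearMap.range_eq_top.2 hq.surj)
  refine ⟨B.toLinearMap ∘ₗ s, fun g => ?_⟩
  have h : s (q g) - g ∈ RingHom.ker B := hker <| by
    have := LinearMap.congr_fun hs (q g)
    rw [RingHom.mem_ker, map_sub, sub_eq_zero]
    exact this
  rwa [RingHom.mem_ker, map_sub, sub_eq_zero] at h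

/-- The map `g ⊗ u ↦ ∑ g₍₂₎ ⊗ (q(g₍₁₎) ⊗ u)`. -/
noncomputable def leftCoact
    (hR : ∀ r : R, leftCoactHom k q (algebraMap R O r) = algebraMap R O r ⊗ₜ 1)
    (U : Type) [AddCommGroup U] [Module k U] : O ⊗[k] U →ₗ[R] O ⊗[k] (L ⊗[k] U) :=
  (TensorProduct.AlgebraTensorModule.assoc k k R O L U).toLinearMap ∘ₗ
    TensorProduct.AlgebraTensorModule.rTensor k U
    ({ (leftCoactHom k q).toLinearMap with
      map_smul' := fun a g => by
        change leftCoactHom k q (a • g) = a • leftCoactHom k q g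
        rw [Algebra.smul_def, map_mul, hR]
        generalize leftCoactHom k q g = z
        induction z with
        | zero => simp
        | add x y hx hy => simp only [mul_add, smul_add, hx, hy]
        | tmul x y => simp [Algebra.smul_def] } : O →ₗ[R] O ⊗[k] L)

theorem leftCoact_tmul (hR : ∀ r : R, leftCoactHom k q (algebraMap R O r) = algebraMap R O r ⊗ₜ 1)
    {U : Type} [AddCommGroup U] [Module k U] (g : O) (u : U) :
    leftCoact hR U (g ⊗ₜ u) = TensorProduct.assoc k O L U (leftCoactHom k q g ⊗ₜ u) := rfl

theorem liftBaseChange_leftCoactHom (β : L →ₗ[k] O ⊗[R] O)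
    (hβ : ∀ g, β (q g) = antipodeSwapHom k R (comul (R := k) g)) (g : O) :
    β.liftBaseChange O (leftCoactHom k q g) = 1 ⊗ₜ g := by
  let s : O ⊗[k] O →ₐ[k] O ⊗[R] O := Algebra.TensorProduct.lift
    ((Algebra.TensorProduct.includeRight : O →ₐ[R] O ⊗[R] O).restrictScalars k)
    (Algebra.TensorProduct.includeLeft : O →ₐ[k] O ⊗[R] O) fun _ _ => Commute.all _ _
  let m : O ⊗[k] O →ₗ[k] O := LinearMap.mul' k O ∘ₗ (HopfAlgebra.antipode k).rTensor O
  have h (z : O ⊗[k] O) : β.liftBaseChange O (Algebra.TensorProduct.map (AlgHom.id k O)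
      (q : O →ₐ[k] L) (Algebra.TensorProduct.comm k O O z)) =
      s (m.lTensor O (TensorProduct.assoc k O O O ((comul (R := k)).rTensor O z))) := by
    induction z with
    | zero => simp
    | add x y hx hy => simp only [map_add, hx, hy]
    | tmul x y =>
      simp [hβ]
      generalize (comul (R := k)) x = z
      induction z with
      | zero => simp
      | add a b ha hb => simp only [map_add, smul_add, TensorProduct.add_tmul, ha, hb]
      | tmul a b => simp [antipodeSwapHom_tmul, s, m, TensorProduct.smul_tmul', mul_comm]
  have hm : m ∘ₗ comul (R := k) = Algebra.linearMap k O ∘ₗ counit (R := k) := by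
    ext x
    exact HopfAlgebra.mul_antipode_rTensor_comul_apply x
  rw [leftCoactHom_apply, h, coassoc_apply, ← LinearMap.lTensor_comp_apply, hm,
    LinearMap.lTensor_comp_apply, lTensor_counit_comul]
  simp [s]

variable {U W : Type} [AddCommGroup U] [Module k U] [AddCommGroup W] [Module k W]

/-- The map `h ⊗ (l ⊗ u) ↦ (h ⊗ 1) β(l) ⊗ u`. -/
noncomputable def expand (β : L →ₗ[k] O ⊗[R] O) (U : Type) [AddCommGroup U] [Module k U] :
    O ⊗[k] (L ⊗[k] U) →ₗ[k] O ⊗[R] (O ⊗[k] U) :=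
  ((TensorProduct.AlgebraTensorModule.assoc k R O O O U).restrictScalars k).toLinearMap ∘ₗ
    ((β.liftBaseChange O).restrictScalars k).rTensor U ∘ₗ
      (TensorProduct.assoc k O L U).symm.toLinearMap

theorem expand_assoc (β : L →ₗ[k] O ⊗[R] O) (z : O ⊗[k] L) (u : U) :
    expand β U (TensorProduct.assoc k O L U (z ⊗ₜ u)) =
      TensorProduct.AlgebraTensorModule.assoc k R O O O U (β.liftBaseChange O z ⊗ₜ u) := by
  simp [expand]

theorem expand_tmul (β : L →ₗ[k] O ⊗[R] O) (h : O) (l : L) (u : U) :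
    expand β U (h ⊗ₜ (l ⊗ₜ u)) =
      TensorProduct.AlgebraTensorModule.assoc k R O O O U ((h • β l) ⊗ₜ u) := by
  simpa using expand_assoc β (h ⊗ₜ l) u

theorem expand_smul_leftCoact
    (hR : ∀ r : R, leftCoactHom k q (algebraMap R O r) = algebraMap R O r ⊗ₜ 1)
    (β : L →ₗ[k] O ⊗[R] O) (hβ : ∀ g, β (q g) = antipodeSwapHom k R (comul (R := k) g))
    (h g : O) (u : U) :
    expand β U (h • leftCoact hR U (g ⊗ₜ u)) = h ⊗ₜ (g ⊗ₜ u) := by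
  have h1 : h • leftCoact hR U (g ⊗ₜ u) =
      TensorProduct.assoc k O L U ((h • leftCoactHom k q g) ⊗ₜ u) := by
    rw [leftCoact_tmul]
    generalize leftCoactHom k q g = z
    induction z with
    | zero => simp
    | add x y hx hy => simp only [map_add, smul_add, TensorProduct.add_tmul, hx, hy]
    | tmul x y => simp [TensorProduct.smul_tmul']
  rw [h1, expand_assoc, map_smul, liftBaseChange_leftCoactHom β hβ]
  simp [TensorProduct.smul_tmul']

variable (k O R U) in
/-- The action map `O ⊗_A (O ⊗ U) → O ⊗ U`. -/
noncomputable def contract : O ⊗[R] (O ⊗[k] U) →ₗ[O] O ⊗[k] U :=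
  (LinearMap.id : O ⊗[k] U →ₗ[R] O ⊗[k] U).liftBaseChange O

theorem contract_tmul (h : O) (x : O ⊗[k] U) : contract k O R U (h ⊗ₜ x) = h • x := by
  simp [contract]

theorem contract_lTensor (f : U →ₗ[k] W) (ξ : O ⊗[R] (O ⊗[k] U)) :
    contract k O R W ((TensorProduct.AlgebraTensorModule.lTensor R O f).lTensor O ξ) =
      TensorProduct.AlgebraTensorModule.lTensor R O f (contract k O R U ξ) := by
  induction ξ with
  | zero => simp
  | add x y hx hy => simp only [map_add, hx, hy]
  | tmul h x =>
    rw [LinearMap.lTensor_tmul, contract_tmul, contract_tmul]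
    induction x with
    | zero => simp
    | add x y hx hy => simp only [map_add, smul_add, hx, hy]
    | tmul g u => simp [TensorProduct.smul_tmul']

theorem expand_contract_lTensor_leftCoact
    (hR : ∀ r : R, leftCoactHom k q (algebraMap R O r) = algebraMap R O r ⊗ₜ 1)
    (β : L →ₗ[k] O ⊗[R] O) (hβ : ∀ g, β (q g) = antipodeSwapHom k R (comul (R := k) g))
    (ξ : O ⊗[R] (O ⊗[k] U)) :
    expand β U (contract k O R _ ((leftCoact hR U).lTensor O ξ)) = ξ := by
  induction ξ with
  | zero => simp
  | add x y hx hy => simp only [map_add, hx, hy]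
  | tmul h x =>
    rw [LinearMap.lTensor_tmul, contract_tmul]
    induction x with
    | zero => simp
    | add x y hx hy => simp only [map_add, smul_add, TensorProduct.tmul_add, hx, hy]
    | tmul g u => exact expand_smul_leftCoact hR β hβ h g u

theorem lTensor_assoc_tmul (f : U →ₗ[k] W) (p : O ⊗[R] O) (u : U) :
    (TensorProduct.AlgebraTensorModule.lTensor R O f).lTensor O
      (TensorProduct.AlgebraTensorModule.assoc k R O O O U (p ⊗ₜ u)) =
      TensorProduct.AlgebraTensorModule.assoc k R O O O W (p ⊗ₜ f u) := by
  induction p with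
  | zero => simp
  | add x y hx hy => simp only [map_add, TensorProduct.add_tmul, hx, hy]
  | tmul x y => simp

theorem lTensor_expand (β : L →ₗ[k] O ⊗[R] O) (f : U →ₗ[k] W) (z : O ⊗[k] (L ⊗[k] U)) :
    (TensorProduct.AlgebraTensorModule.lTensor R O f).lTensor O (expand β U z) =
      expand β W ((f.lTensor L).lTensor O z) := by
  induction z with
  | zero => simp
  | add x y hx hy => simp only [map_add, hx, hy]
  | tmul h x =>
    induction x with
    | zero => simp
    | add x y hx hy => simp only [map_add, TensorProduct.tmul_add, hx, hy]
    | tmul l u => simp only [LinearMap.lTensor_tmul, expand_tmul, lTensor_assoc_tmul]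

theorem lTensor_leftCoact_expand
    (hR : ∀ r : R, leftCoactHom k q (algebraMap R O r) = algebraMap R O r ⊗ₜ 1)
    (hq : Function.Surjective q)
    (β : L →ₗ[k] O ⊗[R] O) (hβ : ∀ g, β (q g) = antipodeSwapHom k R (comul (R := k) g))
    (h : O) (w : L ⊗[k] U) :
    (leftCoact hR U).lTensor O (expand β U (h ⊗ₜ w)) =
      expand β (L ⊗[k] U) (h ⊗ₜ TensorProduct.assoc k L L U
        (((TensorProduct.comm k L L).toLinearMap ∘ₗ comul (R := k)).rTensor U w)) := by
  induction w with
  | zero => simp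
  | add x y hx hy => simp only [map_add, TensorProduct.tmul_add, hx, hy]
  | tmul l u =>
    obtain ⟨g, rfl⟩ := hq l
    have hc (c : k) (y) : TensorProduct.AlgebraTensorModule.assoc k R O O O (L ⊗[k] U) (c • y) =
        c • TensorProduct.AlgebraTensorModule.assoc k R O O O (L ⊗[k] U) y := by
      rw [← algebraMap_smul O c y, map_smul, algebraMap_smul]
    let Ψ : O ⊗[k] (O ⊗[k] O) →ₗ[k] O ⊗[R] (O ⊗[k] (L ⊗[k] U)) := TensorProduct.lift <|
      LinearMap.mk₂ k (fun x z => TensorProduct.AlgebraTensorModule.assoc k R O O O (L ⊗[k] U)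
        ((h • antipodeSwapHom k R z) ⊗ₜ (q x ⊗ₜ u)))
        (fun _ _ _ => by simp only [map_add, TensorProduct.add_tmul, TensorProduct.tmul_add])
        (fun c x z => by
          rw [map_smul, ← TensorProduct.smul_tmul' c (q x), TensorProduct.tmul_smul, hc])
        (fun _ _ _ => by simp only [map_add, smul_add, TensorProduct.add_tmul])
        (fun c x z => by
          rw [map_smul, smul_comm, ← TensorProduct.smul_tmul', hc])
    have hΨ (x : O) (z) : Ψ (x ⊗ₜ z) = TensorProduct.AlgebraTensorModule.assoc k R O O O (L ⊗[k] U)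
        ((h • antipodeSwapHom k R z) ⊗ₜ (q x ⊗ₜ u)) := rfl
    have h1 : ∀ z : O ⊗[k] O, (leftCoact hR U).lTensor O
        (TensorProduct.AlgebraTensorModule.assoc k R O O O U ((h • antipodeSwapHom k R z) ⊗ₜ u)) =
        Ψ (TensorProduct.assoc k O O O ((comul (R := k)).rTensor O z)) := by
      intro z
      induction z with
      | zero => simp
      | add x y hx hy => simp only [map_add, smul_add, TensorProduct.add_tmul, hx, hy]
      | tmul x y =>
        simp only [antipodeSwapHom_tmul, TensorProduct.smul_tmul', LinearMap.rTensor_tmul,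
          TensorProduct.AlgebraTensorModule.assoc_tmul, LinearMap.lTensor_tmul, leftCoact_tmul,
          leftCoactHom_apply]
        generalize comul (R := k) x = w
        induction w with
        | zero => simp
        | add x y hx hy =>
          simp only [map_add, TensorProduct.add_tmul, TensorProduct.tmul_add, hx, hy]
        | tmul a b => simp [hΨ, antipodeSwapHom_tmul, TensorProduct.smul_tmul']
    have h2 : ∀ z : O ⊗[k] O, expand β (L ⊗[k] U) (h ⊗ₜ TensorProduct.assoc k L L U
        (TensorProduct.comm k L L (TensorProduct.map (q : O →ₗ[k] L) (q : O →ₗ[k] L) z) ⊗ₜ u)) =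
        Ψ ((comul (R := k)).lTensor O z) := by
      intro z
      induction z with
      | zero => simp
      | add x y hx hy =>
        simp only [map_add, TensorProduct.add_tmul, TensorProduct.tmul_add, hx, hy]
      | tmul x y => simp [hΨ, expand_tmul, hβ]
    have hΔ : TensorProduct.map (q : O →ₗ[k] L) (q : O →ₗ[k] L) (comul (R := k) g) =
        comul (R := k) (q g) := CoalgHomClass.map_comp_comul_apply q g
    rw [expand_tmul, hβ, h1, coassoc_apply, ← h2, hΔ]
    rfl

theorem contract_expand (hq : Function.Surjective q)
    (β : L →ₗ[k] O ⊗[R] O) (hβ : ∀ g, β (q g) = antipodeSwapHom k R (comul (R := k) g))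
    (h : O) (w : L ⊗[k] U) :
    contract k O R U (expand β U (h ⊗ₜ w)) =
      h ⊗ₜ TensorProduct.lid k U ((counit (R := k)).rTensor U w) := by
  induction w with
  | zero => simp
  | add x y hx hy => simp only [map_add, TensorProduct.tmul_add, hx, hy]
  | tmul l u =>
    obtain ⟨g, rfl⟩ := hq l
    have h1 : ∀ z : O ⊗[k] O, contract k O R U
        (TensorProduct.AlgebraTensorModule.assoc k R O O O U ((h • antipodeSwapHom k R z) ⊗ₜ u)) =
        (h * LinearMap.mul' k O ((HopfAlgebra.antipode k).lTensor O z)) ⊗ₜ u := by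
      intro z
      induction z with
      | zero => simp
      | add x y hx hy => simp only [map_add, smul_add, mul_add, TensorProduct.add_tmul, hx, hy]
      | tmul x y =>
        simp [antipodeSwapHom_tmul, TensorProduct.smul_tmul', contract_tmul, mul_assoc,
          mul_comm x]
    rw [expand_tmul, hβ, h1, HopfAlgebra.mul_antipode_lTensor_comul_apply]
    have hε : counit (R := k) (q g) = counit (R := k) g := CoalgHomClass.counit_comp_apply q g
    simp [hε, mul_comm h, ← Algebra.smul_def, TensorProduct.smul_tmul]

variable (lU : U →ₗ[k] L ⊗[k] U) (lW : W →ₗ[k] L ⊗[k] W)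

/-- The map `g ⊗ u ↦ g ⊗ λ(u) - ∑ g₍₂₎ ⊗ (q(g₍₁₎) ⊗ u)`, whose kernel is the cotensor product. -/
noncomputable def obstruction
    (hR : ∀ r : R, leftCoactHom k q (algebraMap R O r) = algebraMap R O r ⊗ₜ 1) :
    O ⊗[k] U →ₗ[R] O ⊗[k] (L ⊗[k] U) :=
  TensorProduct.AlgebraTensorModule.lTensor R O lU - leftCoact hR U

theorem lTensor_obstruction
    (hR : ∀ r : R, leftCoactHom k q (algebraMap R O r) = algebraMap R O r ⊗ₜ 1)
    (ξ : O ⊗[R] (O ⊗[k] U)) :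
    (obstruction lU hR).lTensor O ξ =
      (TensorProduct.AlgebraTensorModule.lTensor R O lU).lTensor O ξ -
        (leftCoact hR U).lTensor O ξ := by
  rw [obstruction, LinearMap.lTensor_sub, LinearMap.sub_apply]

variable {lU lW}

theorem lTensor_obstruction_expand
    (hR : ∀ r : R, leftCoactHom k q (algebraMap R O r) = algebraMap R O r ⊗ₜ 1)
    (hq : Function.Surjective q)
    (β : L →ₗ[k] O ⊗[R] O) (hβ : ∀ g, β (q g) = antipodeSwapHom k R (comul (R := k) g))
    (hl : ∀ u, lU.lTensor L (lU u) = TensorProduct.assoc k L L U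
      (((TensorProduct.comm k L L).toLinearMap ∘ₗ comul (R := k)).rTensor U (lU u)))
    (x : O ⊗[k] U) : (obstruction lU hR).lTensor O (expand β U (lU.lTensor O x)) = 0 := by
  induction x with
  | zero => simp
  | add x y hx hy => simp only [map_add, hx, hy, add_zero]
  | tmul h u =>
    rw [lTensor_obstruction, lTensor_expand, LinearMap.lTensor_tmul,
      lTensor_leftCoact_expand hR hq β hβ, LinearMap.lTensor_tmul, hl, sub_self]

theorem expand_lTensor_contract
    (hR : ∀ r : R, leftCoactHom k q (algebraMap R O r) = algebraMap R O r ⊗ₜ 1)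
    (β : L →ₗ[k] O ⊗[R] O) (hβ : ∀ g, β (q g) = antipodeSwapHom k R (comul (R := k) g))
    {ξ : O ⊗[R] (O ⊗[k] U)} (hξ : (obstruction lU hR).lTensor O ξ = 0) :
    expand β U (lU.lTensor O (contract k O R U ξ)) = ξ := by
  rw [lTensor_obstruction, sub_eq_zero] at hξ
  conv_rhs => rw [← expand_contract_lTensor_leftCoact hR β hβ ξ, ← hξ, contract_lTensor]
  rfl

theorem contract_expand_lTensor (hq : Function.Surjective q)
    (β : L →ₗ[k] O ⊗[R] O) (hβ : ∀ g, β (q g) = antipodeSwapHom k R (comul (R := k) g))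
    (hl : ∀ u, TensorProduct.lid k U ((counit (R := k)).rTensor U (lU u)) = u) (x : O ⊗[k] U) :
    contract k O R U (expand β U (lU.lTensor O x)) = x := by
  induction x with
  | zero => simp
  | add x y hx hy => simp only [map_add, hx, hy]
  | tmul h u => rw [LinearMap.lTensor_tmul, contract_expand hq β hβ, hl]

theorem obstruction_lTensor
    (hR : ∀ r : R, leftCoactHom k q (algebraMap R O r) = algebraMap R O r ⊗ₜ 1)
    {f : U →ₗ[k] W} (hf : ∀ u, lW (f u) = f.lTensor L (lU u))
    (x : O ⊗[k] U) :
    obstruction lW hR (TensorProduct.AlgebraTensorModule.lTensor R O f x) =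
      (f.lTensor L).lTensor O (obstruction lU hR x) := by
  induction x with
  | zero => simp
  | add x y hx hy => simp only [map_add, hx, hy]
  | tmul g u =>
    have h : (f.lTensor L).lTensor O (leftCoact hR U (g ⊗ₜ u)) = leftCoact hR W (g ⊗ₜ f u) := by
      rw [leftCoact_tmul, leftCoact_tmul]
      generalize leftCoactHom k q g = z
      induction z with
      | zero => simp
      | add x y hx hy => simp only [map_add, TensorProduct.add_tmul, hx, hy]
      | tmul x y => simp
    simp [obstruction, h, hf]

theorem Module.FaithfullyFlat.exact_ker_of_lTensor {R M X Y Z X' Y' Z' : Type*} [CommRing R]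
    [AddCommGroup M] [Module R M] [Module.FaithfullyFlat R M]
    [AddCommGroup X] [Module R X] [AddCommGroup Y] [Module R Y] [AddCommGroup Z] [Module R Z]
    [AddCommGroup X'] [Module R X'] [AddCommGroup Y'] [Module R Y'] [AddCommGroup Z'] [Module R Z']
    {a : X →ₗ[R] X'} {b : Y →ₗ[R] Y'} {c : Z →ₗ[R] Z'} {f : X →ₗ[R] Y} {g : Y →ₗ[R] Z}
    (hf : ∀ x ∈ LinearMap.ker a, f x ∈ LinearMap.ker b)
    (hg : ∀ y ∈ LinearMap.ker b, g y ∈ LinearMap.ker c) (hgf : ∀ x, g (f x) = 0)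
    (H : ∀ ζ : M ⊗[R] Y, b.lTensor M ζ = 0 → g.lTensor M ζ = 0 →
      ∃ η : M ⊗[R] X, a.lTensor M η = 0 ∧ f.lTensor M η = ζ)
    {y : Y} (hy : b y = 0) (hgy : g y = 0) : ∃ x, a x = 0 ∧ f x = y := by
  have sub {P Q : Type _} [AddCommGroup P] [Module R P] [AddCommGroup Q] [Module R Q]
      {p : P →ₗ[R] Q} (η : M ⊗[R] P) (h : p.lTensor M η = 0) :
      ∃ ξ, (LinearMap.ker p).subtype.lTensor M ξ = η :=
    (Module.Flat.lTensor_exact M (LinearMap.exact_subtype_ker_map p) η).1 h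
  have ex : Function.Exact (f.restrict hf) (g.restrict hg) := by
    refine Module.FaithfullyFlat.lTensor_reflects_exact R M _ _ fun ξ => ⟨fun hξ => ?_, ?_⟩
    · obtain ⟨η, h0, h1⟩ := H ((LinearMap.ker b).subtype.lTensor M ξ)
        ((Module.Flat.lTensor_exact M (LinearMap.exact_subtype_ker_map b) _).2 ⟨ξ, rfl⟩) (by
          rw [← LinearMap.lTensor_comp_apply]
          change ((LinearMap.ker c).subtype ∘ₗ g.restrict hg).lTensor M ξ = 0
          rw [LinearMap.lTensor_comp_apply, hξ, map_zero])
      obtain ⟨ξ', rfl⟩ := sub η h0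
      refine ⟨ξ', Module.Flat.lTensor_preserves_injective_linearMap (M := M)
        (LinearMap.ker b).subtype Subtype.val_injective ?_⟩
      rw [← h1, ← LinearMap.lTensor_comp_apply, ← LinearMap.lTensor_comp_apply]
      rfl
    · rintro ⟨ξ, rfl⟩
      rw [← LinearMap.lTensor_comp_apply]
      have : g.restrict hg ∘ₗ f.restrict hf = 0 := by
        ext x
        exact hgf x
      rw [this, LinearMap.lTensor_zero, LinearMap.zero_apply]
  obtain ⟨x, hx⟩ := (ex ⟨y, hy⟩).1 (Subtype.ext hgy)
  exact ⟨x, x.2, congrArg Subtype.val hx⟩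

theorem exists_obstruction_eq_zero [Module.FaithfullyFlat R O]
    (hR : ∀ r : R, leftCoactHom k q (algebraMap R O r) = algebraMap R O r ⊗ₜ 1)
    (hq : Function.Surjective q)
    (β : L →ₗ[k] O ⊗[R] O) (hβ : ∀ g, β (q g) = antipodeSwapHom k R (comul (R := k) g))
    {V : Type} [AddCommGroup V] [Module k V] {lV : V →ₗ[k] L ⊗[k] V}
    (hl : ∀ v, lV.lTensor L (lV v) = TensorProduct.assoc k L L V
      (((TensorProduct.comm k L L).toLinearMap ∘ₗ comul (R := k)).rTensor V (lV v)))
    {f : V →ₗ[k] U} (hf : ∀ v, lU (f v) = f.lTensor L (lV v))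
    {g : U →ₗ[k] W} (hg : ∀ u, lW (g u) = g.lTensor L (lU u)) (h : Function.Exact f g)
    {x : O ⊗[k] U} (hx : obstruction lU hR x = 0) (hgx : g.lTensor O x = 0) :
    ∃ y : O ⊗[k] V, obstruction lV hR y = 0 ∧ f.lTensor O y = x := by
  have hX : Function.Exact (f.lTensor O) (g.lTensor O) := Module.Flat.lTensor_exact O h
  refine Module.FaithfullyFlat.exact_ker_of_lTensor (M := O) (a := obstruction lV hR)
    (b := obstruction lU hR) (c := obstruction lW hR)
    (f := TensorProduct.AlgebraTensorModule.lTensor R O f)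
    (g := TensorProduct.AlgebraTensorModule.lTensor R O g) (fun y hy => ?_) (fun y hy => ?_)
    (fun y => hX.apply_apply_eq_zero y) (fun ζ h0 h1 => ?_) hx hgx
  · rw [LinearMap.mem_ker] at hy ⊢
    rw [obstruction_lTensor hR hf, hy, map_zero]
  · rw [LinearMap.mem_ker] at hy ⊢
    rw [obstruction_lTensor hR hg, hy, map_zero]
  · obtain ⟨η, hη⟩ := (hX (contract k O R U ζ)).1 <| by
      have := contract_lTensor g ζ
      rw [h1, map_zero] at this
      exact this.symm
    refine ⟨expand β V (lV.lTensor O η), lTensor_obstruction_expand hR hq β hβ hl η, ?_⟩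
    rw [lTensor_expand, ← expand_lTensor_contract hR β hβ h0, ← hη,
      ← LinearMap.lTensor_comp_apply, ← LinearMap.lTensor_comp_apply]
    congr 3
    ext v
    exact (hf v).symm

theorem eq_zero_of_ker_obstruction_eq_bot [Module.Flat R O]
    (hR : ∀ r : R, leftCoactHom k q (algebraMap R O r) = algebraMap R O r ⊗ₜ 1)
    (hq : Function.Surjective q)
    (β : L →ₗ[k] O ⊗[R] O) (hβ : ∀ g, β (q g) = antipodeSwapHom k R (comul (R := k) g))
    (hl : ∀ u, lU.lTensor L (lU u) = TensorProduct.assoc k L L U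
      (((TensorProduct.comm k L L).toLinearMap ∘ₗ comul (R := k)).rTensor U (lU u)))
    (hl' : ∀ u, TensorProduct.lid k U ((counit (R := k)).rTensor U (lU u)) = u)
    (h : LinearMap.ker (obstruction lU hR) = ⊥) (x : O ⊗[k] U) : x = 0 := by
  have h0 := Module.Flat.lTensor_preserves_injective_linearMap (M := O) (obstruction lU hR)
    (LinearMap.ker_eq_bot.1 h)
  rw [← contract_expand_lTensor hq β hβ hl' x,
    h0 ((lTensor_obstruction_expand hR hq β hβ hl x).trans (map_zero _).symm), map_zero]

theorem obstruction_comm (hR : ∀ r : R, leftCoactHom k q (algebraMap R O r) = algebraMap R O r ⊗ₜ 1)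
    (ρ : U →ₗ[k] U ⊗[k] L) (x : U ⊗[k] O) :
    obstruction ((TensorProduct.comm k U L).toLinearMap ∘ₗ ρ) hR (TensorProduct.comm k U O x) =
      (((TensorProduct.assoc k U L O).symm ≪≫ₗ (TensorProduct.comm k U L).rTensor O) ≪≫ₗ
        TensorProduct.comm k (L ⊗[k] U) O) (cotensorObstruction k (q : O →ₗ[k] L) ρ x) := by
  induction x with
  | zero => simp only [map_zero]
  | add x y hx hy => simp only [map_add, hx, hy]
  | tmul u g =>
    rw [obstruction, cotensorObstruction, LinearMap.sub_apply, LinearMap.sub_apply, map_sub]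
    congr 1
    · simp
    · rw [TensorProduct.comm_tmul, leftCoact_tmul, leftCoactHom_apply, TensorProduct.map_tmul,
        LinearMap.comp_apply]
      generalize comul (R := k) g = z
      induction z with
      | zero => simp
      | add x y hx hy => simp only [map_add, TensorProduct.add_tmul, TensorProduct.tmul_add, hx, hy]
      | tmul x y => simp

theorem mem_cotensor_iff
    (hR : ∀ r : R, leftCoactHom k q (algebraMap R O r) = algebraMap R O r ⊗ₜ 1)
    {ρ : U →ₗ[k] U ⊗[k] L} {x : U ⊗[k] O} : x ∈ cotensor k (q : O →ₗ[k] L) ρ ↔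
      obstruction ((TensorProduct.comm k U L).toLinearMap ∘ₗ ρ) hR
        (TensorProduct.comm k U O x) = 0 := by
  rw [obstruction_comm, LinearEquiv.map_eq_zero_iff, cotensor, LinearMap.mem_ker]

theorem PaperQuotient.IsComod.lTensor_comm_coassoc {ρ : U →ₗ[k] U ⊗[k] L} (hρ : IsComod k L ρ)
    (u : U) :
    ((TensorProduct.comm k U L).toLinearMap ∘ₗ ρ).lTensor L
        (((TensorProduct.comm k U L).toLinearMap ∘ₗ ρ) u) =
      TensorProduct.assoc k L L U
        (((TensorProduct.comm k L L).toLinearMap ∘ₗ comul (R := k)).rTensor U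
          (((TensorProduct.comm k U L).toLinearMap ∘ₗ ρ) u)) := by
  let w : U ⊗[k] (L ⊗[k] L) →ₗ[k] L ⊗[k] (L ⊗[k] U) :=
    (TensorProduct.assoc k L L U).toLinearMap ∘ₗ
      (TensorProduct.comm k U (L ⊗[k] L)).toLinearMap ∘ₗ
        (TensorProduct.comm k L L).toLinearMap.lTensor U
  have h := congrArg w (hρ.coassoc u)
  have h1 (z : U ⊗[k] L) : w (TensorProduct.assoc k U L L (TensorProduct.map ρ LinearMap.id z)) =
      ((TensorProduct.comm k U L).toLinearMap ∘ₗ ρ).lTensor L (TensorProduct.comm k U L z) := by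
    induction z with
    | zero => simp
    | add x y hx hy => simp only [map_add, hx, hy]
    | tmul u l =>
      simp only [TensorProduct.map_tmul, LinearMap.id_apply, TensorProduct.comm_tmul,
        LinearMap.lTensor_tmul, LinearMap.comp_apply]
      generalize ρ u = z
      induction z with
      | zero => simp
      | add x y hx hy => simp only [map_add, TensorProduct.add_tmul, TensorProduct.tmul_add, hx, hy]
      | tmul x y => simp [w]
  have h2 (z : U ⊗[k] L) : w (TensorProduct.map LinearMap.id (comul (R := k)) z) =
      TensorProduct.assoc k L L U
        (((TensorProduct.comm k L L).toLinearMap ∘ₗ comul (R := k)).rTensor U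
          (TensorProduct.comm k U L z)) := by
    induction z with
    | zero => simp
    | add x y hx hy => simp only [map_add, hx, hy]
    | tmul u l => simp [w]
  rw [h1, h2] at h
  exact h

theorem PaperQuotient.IsComod.lid_counit_comm {ρ : U →ₗ[k] U ⊗[k] L} (hρ : IsComod k L ρ) (u : U) :
    TensorProduct.lid k U ((Coalgebra.counit (R := k)).rTensor U
      (((TensorProduct.comm k U L).toLinearMap ∘ₗ ρ) u)) = u := by
  have h (z : U ⊗[k] L) :
      TensorProduct.lid k U ((Coalgebra.counit (R := k)).rTensor U (TensorProduct.comm k U L z)) =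
        TensorProduct.rid k U (TensorProduct.map LinearMap.id (Coalgebra.counit (R := k)) z) := by
    induction z with
    | zero => simp
    | add x y hx hy => simp only [map_add, hx, hy]
    | tmul u l => simp
  exact (h _).trans (hρ.counit u)

theorem comm_rTensor (f : U →ₗ[k] W) (X : Type) [AddCommGroup X] [Module k X] (z : U ⊗[k] X) :
    TensorProduct.comm k W X (f.rTensor X z) = f.lTensor X (TensorProduct.comm k U X z) := by
  induction z with
  | zero => simp
  | add x y hx hy => simp only [map_add, hx, hy]
  | tmul u l => simp

theorem PaperQuotient.IsColinear.comm_apply {ρU : U →ₗ[k] U ⊗[k] L} {ρW : W →ₗ[k] W ⊗[k] L}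
    {f : U →ₗ[k] W} (hf : IsColinear k L ρU ρW f) (u : U) :
    ((TensorProduct.comm k W L).toLinearMap ∘ₗ ρW) (f u) =
      f.lTensor L (((TensorProduct.comm k U L).toLinearMap ∘ₗ ρU) u) :=
  (congrArg (TensorProduct.comm k W L) (hf u)).trans (comm_rTensor f L (ρU u))

theorem rTensor_mem_cotensor
    (hR : ∀ r : R, leftCoactHom k q (algebraMap R O r) = algebraMap R O r ⊗ₜ 1)
    {ρU : U →ₗ[k] U ⊗[k] L} {ρW : W →ₗ[k] W ⊗[k] L}
    {f : U →ₗ[k] W} (hf : IsColinear k L ρU ρW f) {x : U ⊗[k] O}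
    (hx : x ∈ cotensor k (q : O →ₗ[k] L) ρU) :
    f.rTensor O x ∈ cotensor k (q : O →ₗ[k] L) ρW := by
  rw [mem_cotensor_iff hR] at hx ⊢
  rw [comm_rTensor]
  exact (obstruction_lTensor hR hf.comm_apply _).trans (by rw [hx, map_zero])

end Descent

open PaperQuotient in
/-- The induced representation functor `U ↦ U □_L O` is faithfully
exact: it sends exact sequences of `L`-comodules to exact sequences, and kills no
nonzero comodule. -/
theorem statement5
    (k : Type) [Field k] (O : Type) [CommRing O] [HopfAlgebra k O]
    (A : Subalgebra k O) (hA : IsHopfSub k O A)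
    (L : Type) [CommRing L] [HopfAlgebra k L]
    (q : O →ₐc[k] L) (hq : IsQuotientHopf k O L A q)
    (U' : Type) [AddCommGroup U'] [Module k U']
    (ρU' : U' →ₗ[k] U' ⊗[k] L) (hU' : IsComod k L ρU')
    (U : Type) [AddCommGroup U] [Module k U]
    (ρU : U →ₗ[k] U ⊗[k] L) (hU : IsComod k L ρU)
    (U'' : Type) [AddCommGroup U''] [Module k U'']
    (ρU'' : U'' →ₗ[k] U'' ⊗[k] L) (hU'' : IsComod k L ρU'')
    (f : U' →ₗ[k] U) (hf : IsColinear k L ρU' ρU f)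
    (g : U →ₗ[k] U'') (hg : IsColinear k L ρU ρU'' g)
    (hexact : Function.Exact ⇑f ⇑g) :
    -- (a) the induced maps restrict to the cotensor products and form an exact sequence
    ((∀ y ∈ cotensor k (q : O →ₗ[k] L) ρU',
        (LinearMap.rTensor O f) y ∈ cotensor k (q : O →ₗ[k] L) ρU) ∧
      (∀ x ∈ cotensor k (q : O →ₗ[k] L) ρU,
        (LinearMap.rTensor O g) x ∈ cotensor k (q : O →ₗ[k] L) ρU'') ∧
      (∀ x ∈ cotensor k (q : O →ₗ[k] L) ρU,
        ((LinearMap.rTensor O g) x = 0 ↔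
          ∃ y ∈ cotensor k (q : O →ₗ[k] L) ρU', (LinearMap.rTensor O f) y = x))) ∧
    -- (b) faithfulness: a nonzero comodule has nonzero cotensor product with `O`
    ((∃ u : U, u ≠ 0) → cotensor k (q : O →ₗ[k] L) ρU ≠ ⊥ ) := by
  have hR (a : A) : leftCoactHom k q (algebraMap A O a) = algebraMap A O a ⊗ₜ 1 :=
    hq.leftCoactHom_coe hA a
  obtain ⟨β, hβ⟩ := hq.exists_section hA
  have := hA.faithfullyFlat
  refine ⟨⟨fun y hy => rTensor_mem_cotensor hR hf hy, fun x hx => rTensor_mem_cotensor hR hg hx,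
    fun x hx => ⟨fun hgx => ?_, ?_⟩⟩, ?_⟩
  · obtain ⟨y, hy, hyx⟩ := exists_obstruction_eq_zero hR hq.surj β hβ hU'.lTensor_comm_coassoc
      hf.comm_apply hg.comm_apply hexact ((mem_cotensor_iff hR).1 hx)
      (by rw [← comm_rTensor, hgx, map_zero])
    obtain ⟨y, rfl⟩ := (TensorProduct.comm k U' O).surjective y
    rw [← comm_rTensor] at hyx
    exact ⟨y, (mem_cotensor_iff hR).2 hy, (TensorProduct.comm k U O).injective hyx⟩
  · rintro ⟨y, -, rfl⟩
    rw [← LinearMap.rTensor_comp_apply, hexact.linearMap_comp_eq_zero, LinearMap.rTensor_zero,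
      LinearMap.zero_apply]
  · rintro ⟨u, hu⟩ hbot
    have hker : LinearMap.ker
        (obstruction ((TensorProduct.comm k U L).toLinearMap ∘ₗ ρU) hR) = ⊥ := by
      refine (Submodule.eq_bot_iff _).2 fun x hx => ?_
      obtain ⟨x, rfl⟩ := (TensorProduct.comm k U O).surjective x
      have h : x ∈ cotensor k (q : O →ₗ[k] L) ρU := (mem_cotensor_iff hR).2 hx
      rw [hbot, Submodule.mem_bot] at h
      rw [h, map_zero]
    have h := eq_zero_of_ker_obstruction_eq_bot hR hq.surj β hβ hU.lTensor_comm_coassoc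
      hU.lid_counit_comm hker (1 ⊗ₜ u)
    refine hu ?_
    simpa using congrArg
      (fun z => TensorProduct.lid k U ((Coalgebra.counit (R := k) (A := O)).rTensor U z)) h
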